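/- In an orthogonal FDSLRM, with Σ = σ₀²I_n + VDV', the matrix T̂ΣT̂' is diagonal with entries (T̂ΣT̂')ⱼⱼ = ρⱼσⱼ², where ρⱼ = σⱼ²‖vⱼ‖²/(σ₀² + σⱼ²‖vⱼ‖²). Consequently the BLUP natural estimators in an orthogonal FDSLRM have mean ρⱼσⱼ², variance 2ρⱼ²σⱼ⁴ and pairwise zero covariances under Gaussianity. -/

import Mathlib

open Matrix MeasureTheory ProbabilityTheory

/-- The exponentially tilted moments of a centred Gaussian satisfy the differential recursion of
their generating function. -/
lemma integral_pow_succ_mul_exp_gaussianReal_of_hasDerivAt {v : NNReal} {m : ℕ} {f f' : ℝ → ℝ}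
    (hf : ∀ t, ∫ x, x ^ m * Real.exp (t * x) ∂gaussianReal 0 v = f t)
    (hf' : ∀ t, HasDerivAt f (f' t) t) (t : ℝ) :
    ∫ x, x ^ (m + 1) * Real.exp (t * x) ∂gaussianReal 0 v = f' t := by
  have h := hasDerivAt_integral_pow_mul_exp_real (X := id) (μ := gaussianReal 0 v) (t := t)
    (by simp [integrableExpSet_id_gaussianReal]) m
  have hfun : (fun t ↦ ∫ x, id x ^ m * Real.exp (t * id x) ∂gaussianReal 0 v) = f := funext hf
  rw [hfun] at h
  exact h.unique (hf' t)

lemma integral_sq_and_pow_four_gaussianReal (v : NNReal) :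
    ∫ x, x ^ 2 ∂gaussianReal 0 v = v ∧ ∫ x, x ^ 4 ∂gaussianReal 0 v = 3 * (v : ℝ) ^ 2 := by
  obtain ⟨c, hc⟩ : ∃ c : ℝ, (v : ℝ) = c := ⟨_, rfl⟩
  rw [hc]
  have hexp (t : ℝ) : HasDerivAt (fun t : ℝ ↦ Real.exp (c * t ^ 2 / 2))
      (Real.exp (c * t ^ 2 / 2) * (c * t)) t := by
    refine ((((hasDerivAt_pow 2 t).const_mul c).div_const 2).exp).congr_deriv ?_
    push_cast
    ring
  have h0 (t : ℝ) : ∫ x, x ^ 0 * Real.exp (t * x) ∂gaussianReal 0 v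
      = Real.exp (c * t ^ 2 / 2) := by
    have := congrFun (mgf_id_gaussianReal (μ := 0) (v := v)) t
    simpa [mgf, hc] using this
  have h1 := integral_pow_succ_mul_exp_gaussianReal_of_hasDerivAt h0 hexp
  have h2 := integral_pow_succ_mul_exp_gaussianReal_of_hasDerivAt h1
    (f' := fun t ↦ (c + c ^ 2 * t ^ 2) * Real.exp (c * t ^ 2 / 2)) fun t ↦ by
      refine ((hexp t).mul ((hasDerivAt_id' t).const_mul c)).congr_deriv ?_
      ring
  have h3 := integral_pow_succ_mul_exp_gaussianReal_of_hasDerivAt h2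
    (f' := fun t ↦ (3 * c ^ 2 * t + c ^ 3 * t ^ 3) * Real.exp (c * t ^ 2 / 2)) fun t ↦ by
      refine ((((hasDerivAt_pow 2 t).const_mul (c ^ 2)).const_add c).mul (hexp t)).congr_deriv ?_
      push_cast
      ring
  have h4 := integral_pow_succ_mul_exp_gaussianReal_of_hasDerivAt h3
    (f' := fun t ↦ (3 * c ^ 2 + 6 * c ^ 3 * t ^ 2 + c ^ 4 * t ^ 4)
      * Real.exp (c * t ^ 2 / 2)) fun t ↦ by
      refine ((((hasDerivAt_id' t).const_mul (3 * c ^ 2)).add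
        ((hasDerivAt_pow 3 t).const_mul (c ^ 3))).mul (hexp t)).congr_deriv ?_
      simp only [Pi.add_apply]
      push_cast
      ring
  exact ⟨by simpa using h2 0, by simpa using h4 0⟩

section CentredGaussian

variable {Ω : Type*} [MeasurableSpace Ω] {μ : Measure Ω} {Y Z : Ω → ℝ} {a b : NNReal}

lemma integrable_pow_of_map_eq_gaussianReal (hY : Measurable Y)
    (h : μ.map Y = gaussianReal 0 a) (m : ℕ) : Integrable (fun ω ↦ Y ω ^ m) μ := by
  have hi : Integrable (fun x : ℝ ↦ x ^ m) (gaussianReal 0 a) := by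
    simpa using (memLp_id_gaussianReal' (μ := 0) (v := a) m (by simp)).integrable_norm_pow'.mono
      (by fun_prop : AEStronglyMeasurable (fun x : ℝ ↦ x ^ m) _) (by simp)
  rw [← h] at hi
  exact hi.comp_measurable hY

lemma integral_sq_of_map_eq_gaussianReal (hY : Measurable Y)
    (h : μ.map Y = gaussianReal 0 a) : ∫ ω, Y ω ^ 2 ∂μ = a := by
  rw [← (integral_sq_and_pow_four_gaussianReal a).1, ← h,
    integral_map hY.aemeasurable (by fun_prop)]

lemma integral_pow_four_of_map_eq_gaussianReal (hY : Measurable Y)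
    (h : μ.map Y = gaussianReal 0 a) : ∫ ω, Y ω ^ 4 ∂μ = 3 * (a : ℝ) ^ 2 := by
  rw [← (integral_sq_and_pow_four_gaussianReal a).2, ← h,
    integral_map hY.aemeasurable (by fun_prop)]

lemma variance_sq_of_map_eq_gaussianReal [IsProbabilityMeasure μ] (hY : Measurable Y)
    (h : μ.map Y = gaussianReal 0 a) : variance (fun ω ↦ Y ω ^ 2) μ = 2 * (a : ℝ) ^ 2 := by
  have hpow : ((fun ω ↦ Y ω ^ 2) ^ 2 : Ω → ℝ) = fun ω ↦ Y ω ^ 4 := by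
    ext ω
    simp only [Pi.pow_apply]
    ring
  have hLp : MemLp (fun ω ↦ Y ω ^ 2) 2 μ := by
    rw [memLp_two_iff_integrable_sq (hY.pow_const 2).aestronglyMeasurable]
    simp_rw [← pow_mul]
    exact integrable_pow_of_map_eq_gaussianReal hY h 4
  rw [variance_eq_sub hLp, hpow, integral_sq_of_map_eq_gaussianReal hY h,
    integral_pow_four_of_map_eq_gaussianReal hY h]
  ring

/-- Squares of centred Gaussian variables whose sum and difference are Gaussian with the variance
of the independent case are uncorrelated. -/
lemma integral_sq_sub_mul_sq_sub_eq_zero [IsProbabilityMeasure μ]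
    (hY : Measurable Y) (hZ : Measurable Z)
    (hYa : μ.map Y = gaussianReal 0 a) (hZb : μ.map Z = gaussianReal 0 b)
    (hadd : μ.map (fun ω ↦ Y ω + Z ω) = gaussianReal 0 (a + b))
    (hsub : μ.map (fun ω ↦ Y ω - Z ω) = gaussianReal 0 (a + b)) :
    ∫ ω, (Y ω ^ 2 - a) * (Z ω ^ 2 - b) ∂μ = 0 := by
  have hP := integrable_pow_of_map_eq_gaussianReal (hY.add hZ) hadd 4
  have hM := integrable_pow_of_map_eq_gaussianReal (hY.sub hZ) hsub 4
  have hY4 := integrable_pow_of_map_eq_gaussianReal hY hYa 4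
  have hZ4 := integrable_pow_of_map_eq_gaussianReal hZ hZb 4
  have hY2 := integrable_pow_of_map_eq_gaussianReal hY hYa 2
  have hZ2 := integrable_pow_of_map_eq_gaussianReal hZ hZb 2
  have eP := integral_pow_four_of_map_eq_gaussianReal (hY.add hZ) hadd
  have eM := integral_pow_four_of_map_eq_gaussianReal (hY.sub hZ) hsub
  have eY4 := integral_pow_four_of_map_eq_gaussianReal hY hYa
  have eZ4 := integral_pow_four_of_map_eq_gaussianReal hZ hZb
  have eY2 := integral_sq_of_map_eq_gaussianReal hY hYa
  have eZ2 := integral_sq_of_map_eq_gaussianReal hZ hZb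
  have hpolar : ∀ ω, (Y ω ^ 2 - a) * (Z ω ^ 2 - b) =
      1 / 12 * (Y ω + Z ω) ^ 4 + 1 / 12 * (Y ω - Z ω) ^ 4 - 1 / 6 * Y ω ^ 4 - 1 / 6 * Z ω ^ 4
        - b * Y ω ^ 2 - a * Z ω ^ 2 + a * b := fun ω ↦ by ring
  simp only [Pi.add_apply, Pi.sub_apply] at hP hM eP eM
  simp_rw [hpolar]
  rw [integral_add (by fun_prop) (by fun_prop), integral_sub (by fun_prop) (by fun_prop),
    integral_sub (by fun_prop) (by fun_prop), integral_sub (by fun_prop) (by fun_prop),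
    integral_sub (by fun_prop) (by fun_prop), integral_add (by fun_prop) (by fun_prop)]
  simp only [integral_const_mul, eP, eM, eY4, eZ4, eY2, eZ2, integral_const, probReal_univ,
    NNReal.coe_add, smul_eq_mul]
  ring

end CentredGaussian

/-- In an orthogonal FDSLRM, `T̂ΣT̂'` is diagonal with entries `ρⱼσⱼ²`;
consequently under Gaussianity the BLUP natural estimators `((T̂X)ⱼ)²` have
mean `ρⱼσⱼ²`, variance `2ρⱼ²σⱼ⁴` and pairwise zero covariances. -/
theorem stmt_11 {n k l : ℕ} (hn : 0 < n) (hk : 0 < k) (hl : 0 < l)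
    (hnkl : k + l < n)
    (F : Matrix (Fin n) (Fin k) ℝ) (hF : F.rank = k)
    (V : Matrix (Fin n) (Fin l) ℝ)
    (hcols : ∀ j : Fin l, (fun i => V i j) ≠ 0)
    (nv : Fin l → ℝ) (hnv : ∀ j, nv j = ∑ i, V i j ^ 2)
    (hFV : Fᵀ * V = 0) (hVV : Vᵀ * V = Matrix.diagonal nv)
    (σ0 : ℝ) (hσ0 : 0 < σ0)
    (σ : Fin l → ℝ) (hσ : ∀ j, 0 < σ j)
    (D : Matrix (Fin l) (Fin l) ℝ) (hD : D = Matrix.diagonal σ)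
    (Mf : Matrix (Fin n) (Fin n) ℝ) (hMf : Mf = 1 - F * (Fᵀ * F)⁻¹ * Fᵀ)
    (What : Matrix (Fin l) (Fin l) ℝ) (hWhat : What = Vᵀ * Mf * V + σ0 • D⁻¹)
    (That : Matrix (Fin l) (Fin n) ℝ) (hThat : That = What⁻¹ * Vᵀ * Mf)
    (Sigma : Matrix (Fin n) (Fin n) ℝ)
    (hSigma : Sigma = σ0 • (1 : Matrix (Fin n) (Fin n) ℝ) + V * D * Vᵀ)
    (ρ : Fin l → ℝ) (hρ : ∀ j, ρ j = σ j * nv j / (σ0 + σ j * nv j))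
    (Ω : Type) [MeasurableSpace Ω] (μ : Measure Ω) [IsProbabilityMeasure μ]
    (X : Ω → Fin n → ℝ) (hXmeas : ∀ i, Measurable fun ω => X ω i)
    (β : Fin k → ℝ)
    (hgauss : ∀ t : Fin n → ℝ,
      μ.map (fun ω => ∑ i, t i * X ω i) =
        gaussianReal (∑ i, t i * F.mulVec β i)
          (Real.toNNReal (∑ i, ∑ i', t i * Sigma i i' * t i'))) :
    That * Sigma * Thatᵀ = Matrix.diagonal (fun j => ρ j * σ j) ∧
    (∀ j : Fin l, ∫ ω, (That.mulVec (X ω) j) ^ 2 ∂μ = ρ j * σ j) ∧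
    (∀ j : Fin l, variance (fun ω => (That.mulVec (X ω) j) ^ 2) μ
        = 2 * ρ j ^ 2 * σ j ^ 2) ∧
    (∀ i j : Fin l, i ≠ j →
      ∫ ω, ((That.mulVec (X ω) i) ^ 2 - ∫ ω', (That.mulVec (X ω') i) ^ 2 ∂μ) *
           ((That.mulVec (X ω) j) ^ 2 - ∫ ω', (That.mulVec (X ω') j) ^ 2 ∂μ) ∂μ
        = 0) := by
  have hVF : Vᵀ * F = 0 := by
    rw [← Matrix.transpose_transpose F, ← Matrix.transpose_mul, hFV, Matrix.transpose_zero]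
  have hVM : Vᵀ * Mf = Vᵀ := by
    rw [hMf, Matrix.mul_sub, Matrix.mul_one, ← Matrix.mul_assoc, ← Matrix.mul_assoc, hVF]
    simp
  have hnv0 : ∀ j, 0 ≤ nv j := fun j ↦ hnv j ▸ Finset.sum_nonneg fun i _ ↦ sq_nonneg _
  have hden : ∀ j, 0 < σ0 + σ j * nv j := fun j ↦
    add_pos_of_pos_of_nonneg hσ0 (mul_nonneg (hσ j).le (hnv0 j))
  have hDinv : D⁻¹ = Matrix.diagonal fun j ↦ (σ j)⁻¹ := by
    refine Matrix.inv_eq_right_inv ?_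
    rw [hD, Matrix.diagonal_mul_diagonal, ← Matrix.diagonal_one]
    congr 1
    ext j
    exact mul_inv_cancel₀ (hσ j).ne'
  have hWinv : What⁻¹ = Matrix.diagonal fun j ↦ σ j / (σ0 + σ j * nv j) := by
    refine Matrix.inv_eq_right_inv ?_
    rw [hWhat, hVM, hVV, hDinv, ← Matrix.diagonal_smul, Matrix.diagonal_add,
      Matrix.diagonal_mul_diagonal, ← Matrix.diagonal_one]
    congr 1
    ext j
    have hsum : nv j + σ0 * (σ j)⁻¹ = (σ0 + σ j * nv j) / σ j := by
      have := (hσ j).ne'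
      field_simp
      ring
    simp only [Pi.smul_apply, smul_eq_mul]
    rw [hsum, div_mul_div_cancel₀ (hσ j).ne', div_self (hden j).ne']
  have hT : That = (Matrix.diagonal fun j ↦ σ j / (σ0 + σ j * nv j)) * Vᵀ := by
    rw [hThat, Matrix.mul_assoc, hVM, hWinv]
  have hTF : That * F = 0 := by rw [hT, Matrix.mul_assoc, hVF, Matrix.mul_zero]
  have hcov : That * Sigma * Thatᵀ = Matrix.diagonal (fun j => ρ j * σ j) := by
    have hVSV : Vᵀ * Sigma * V = Matrix.diagonal fun j ↦ σ0 * nv j + nv j * σ j * nv j := by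
      have hassoc : Vᵀ * Sigma * V = σ0 • (Vᵀ * V) + (Vᵀ * V) * D * (Vᵀ * V) := by
        simp [hSigma, Matrix.mul_add, Matrix.add_mul, Matrix.mul_assoc]
      rw [hassoc, hVV, hD, Matrix.diagonal_mul_diagonal, Matrix.diagonal_mul_diagonal,
        ← Matrix.diagonal_smul, Matrix.diagonal_add]
      rfl
    rw [hT, Matrix.transpose_mul, Matrix.transpose_transpose, Matrix.diagonal_transpose]
    rw [← Matrix.mul_assoc, Matrix.mul_assoc _ Vᵀ, Matrix.mul_assoc _ (Vᵀ * Sigma), hVSV,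
      Matrix.diagonal_mul_diagonal, Matrix.diagonal_mul_diagonal]
    congr 1
    ext j
    have := (hden j).ne'
    rw [hρ]
    field_simp
  have hmeas : ∀ j, Measurable fun ω ↦ That.mulVec (X ω) j := fun j ↦ by
    simp only [Matrix.mulVec, dotProduct]
    exact Finset.measurable_sum _ fun i _ ↦ (hXmeas i).const_mul _
  have hvar0 : ∀ j, 0 ≤ ρ j * σ j := fun j ↦ by
    rw [hρ]
    have := hσ j
    have := hnv0 j
    have := hden j
    positivity
  have hlaw : ∀ s : Fin l → ℝ, μ.map (fun ω ↦ s ⬝ᵥ That.mulVec (X ω)) =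
      gaussianReal 0 (Real.toNNReal (∑ j, ρ j * σ j * s j ^ 2)) := by
    intro s
    have h := hgauss (s ᵥ* That)
    have hmean : ∑ i, (s ᵥ* That) i * F.mulVec β i = 0 := by
      change (s ᵥ* That) ⬝ᵥ (F *ᵥ β) = 0
      rw [← Matrix.dotProduct_mulVec, Matrix.mulVec_mulVec, hTF]
      simp
    have hvar : ∑ i, ∑ i', (s ᵥ* That) i * Sigma i i' * (s ᵥ* That) i' =
        ∑ j, ρ j * σ j * s j ^ 2 := by
      calc _ = (s ᵥ* That) ⬝ᵥ (Sigma *ᵥ (s ᵥ* That)) := by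
            simp only [dotProduct, Matrix.mulVec, Finset.mul_sum, mul_assoc]
        _ = s ⬝ᵥ ((That * Sigma * Thatᵀ) *ᵥ s) := by
            rw [← Matrix.dotProduct_mulVec, ← Matrix.mulVec_transpose That s,
              Matrix.mulVec_mulVec, Matrix.mulVec_mulVec, Matrix.mul_assoc]
        _ = _ := by
            rw [hcov]
            simp only [dotProduct, Matrix.mulVec_diagonal]
            exact Finset.sum_congr rfl fun j _ ↦ by ring
    rw [hmean, hvar] at h
    rw [← h]
    congr 1
    ext ω
    exact Matrix.dotProduct_mulVec _ _ _
  have hlaw1 : ∀ j, μ.map (fun ω ↦ That.mulVec (X ω) j) =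
      gaussianReal 0 (Real.toNNReal (ρ j * σ j)) := fun j ↦ by
    simpa [Pi.single_apply, ite_pow] using hlaw (Pi.single j 1)
  have hmean2 : ∀ j, ∫ ω, (That.mulVec (X ω) j) ^ 2 ∂μ = ρ j * σ j := fun j ↦ by
    rw [integral_sq_of_map_eq_gaussianReal (hmeas j) (hlaw1 j), Real.coe_toNNReal _ (hvar0 j)]
  refine ⟨hcov, hmean2, fun j ↦ ?_, fun i j hij ↦ ?_⟩
  · rw [variance_sq_of_map_eq_gaussianReal (hmeas j) (hlaw1 j), Real.coe_toNNReal _ (hvar0 j)]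
    ring
  · have hpair : ∀ c : ℝ, c ^ 2 = 1 →
        μ.map (fun ω ↦ That.mulVec (X ω) i + c * That.mulVec (X ω) j) =
          gaussianReal 0 (Real.toNNReal (ρ i * σ i) + Real.toNNReal (ρ j * σ j)) := by
      intro c hc
      have h := hlaw (Pi.single i 1 + Pi.single j c)
      have hsum : ∑ m, ρ m * σ m * (Pi.single i 1 + Pi.single j c : Fin l → ℝ) m ^ 2 =
          ρ i * σ i + ρ j * σ j := by
        rw [Fintype.sum_eq_add i j hij fun m hm ↦ by simp [hm.1, hm.2]]
        simp [hij, hij.symm, hc]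
      rw [hsum, Real.toNNReal_add (hvar0 i) (hvar0 j)] at h
      simpa [add_dotProduct] using h
    have h := integral_sq_sub_mul_sq_sub_eq_zero (hmeas i) (hmeas j) (hlaw1 i) (hlaw1 j)
      (by simpa using hpair 1 (by norm_num))
      (by simpa [← sub_eq_add_neg] using hpair (-1) (by norm_num))
    rw [Real.coe_toNNReal _ (hvar0 i), Real.coe_toNNReal _ (hvar0 j)] at h
    simpa only [hmean2] using h
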